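/- Let N be a positive integer and b, c, c', d complex numbers with Re(1-N+b+c-d) > 0 (and no denominator parameter a nonpositive integer). Then Σ_{m,n} (-N)_m(b)_m(c)_m (d+N)_n(d-b)_n(c')_n / ((d)_{m+n}(1-N+b+c-d)_m(1+c+c')_n m! n!) = [(d-b)_N (d-c-c')_N / ((d)_N (d-b-c)_N)] · Γ(1+c+c')Γ(1+b+c-d) / (Γ(1+c)Γ(1+b+c+c'-d)). -/

import Mathlib

open Complex Finset

/-- Pochhammer symbol `(a)_k = a(a+1)⋯(a+k-1)`. -/
noncomputable def poch (a : ℂ) (k : ℕ) : ℂ := ∏ i ∈ Finset.range k, (a + i)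

/-- `z` is not a nonpositive integer. -/
def notNonposInt (z : ℂ) : Prop := ∀ k : ℕ, z ≠ -(k : ℂ)

open Filter Topology

lemma poch_zero (a : ℂ) : poch a 0 = 1 := by simp [poch]

lemma poch_succ (a : ℂ) (k : ℕ) : poch a (k+1) = poch a k * (a + k) := by
  simp [poch, Finset.prod_range_succ]

lemma poch_add (a : ℂ) (j k : ℕ) : poch a (j + k) = poch a j * poch (a + j) k := by
  simp only [poch, Finset.prod_range_add]
  congr 1
  apply Finset.prod_congr rfl
  intro i _
  push_cast; ring

lemma poch_ne_zero {a : ℂ} (h : notNonposInt a) (k : ℕ) : poch a k ≠ 0 := by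
  rw [poch, Finset.prod_ne_zero_iff]
  intro i _ h0
  exact h i (eq_neg_of_add_eq_zero_left h0)

lemma poch_succ' (a : ℂ) (k : ℕ) : poch a (k+1) = a * poch (a + 1) k := by
  rw [add_comm k 1, poch_add]; simp [poch]

lemma poch_reflect (z : ℂ) (k : ℕ) : poch (1 - k - z) k = (-1)^k * poch z k := by
  have h : ((-1:ℂ))^k = ∏ i ∈ Finset.range k, (-1 : ℂ) := by simp
  rw [poch, poch, h, ← Finset.prod_mul_distrib, ← Finset.prod_range_reflect]
  apply Finset.prod_congr rfl
  intro i hi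
  have hi' : i + 1 ≤ k := Finset.mem_range.mp hi
  rw [Nat.sub_sub, Nat.cast_sub (by omega)]
  push_cast; ring

lemma poch_neg_nat (N m : ℕ) :
    poch (-(N:ℂ)) m = (-1)^m * (Nat.factorial m : ℂ) * (Nat.choose N m : ℂ) := by
  induction m with
  | zero => simp [poch]
  | succ m ih =>
    rw [poch_succ, ih]
    have h : (Nat.choose N (m+1) : ℂ) * (m+1) = (Nat.choose N m : ℂ) * (N - m) := by
      rcases le_or_gt m N with hm | hm
      · have := Nat.choose_succ_right_eq N m
        have h2 := congrArg (Nat.cast : ℕ → ℂ) this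
        rw [Nat.cast_mul, Nat.cast_mul, Nat.cast_sub hm] at h2
        exact_mod_cast h2
      · rw [Nat.choose_eq_zero_of_lt hm, Nat.choose_eq_zero_of_lt (by omega)]; simp
    rw [Nat.factorial_succ]
    push_cast
    linear_combination -(-1)^(m+1) * (Nat.factorial m : ℂ) * h

lemma vander_anti (x y : ℂ) (M : ℕ) :
    ∑ p ∈ Finset.HasAntidiagonal.antidiagonal M, (Nat.choose M p.1 : ℂ) * (poch x p.1 * poch y p.2)
      = poch (x + y) M := by
  induction M with
  | zero => simp [poch]
  | succ M ih =>
    rw [Finset.sum_antidiagonal_choose_succ_mul (fun i j => poch x i * poch y j),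
      poch_succ, ← ih, ← Finset.sum_add_distrib, Finset.sum_mul]
    apply Finset.sum_congr rfl
    intro p hp
    have hp' : p.1 + p.2 = M := by simpa using hp
    have hc : Nat.choose M p.2 = Nat.choose M p.1 := by
      rw [← hp', Nat.choose_symm_add]
    rw [poch_succ, poch_succ, hc, ← hp']
    push_cast; ring

lemma vander (x y : ℂ) (M : ℕ) :
    ∑ i ∈ Finset.range (M+1), (Nat.choose M i : ℂ) * (poch x i * poch y (M - i))
      = poch (x + y) M := by
  rw [← vander_anti, Finset.Nat.sum_antidiagonal_eq_sum_range_succ_mk]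

lemma vander2 (e c : ℂ) (k : ℕ) :
    ∑ j ∈ Finset.range (k+1), (-1)^j * (Nat.choose k j : ℂ) * (poch c j * poch (e + j) (k - j))
      = poch (e - c) k := by
  have h := vander c (1 - k - e) k
  have h2 : c + (1 - k - e) = 1 - k - (e - c) := by ring
  rw [h2, poch_reflect] at h
  have hs : ((-1:ℂ))^k * (-1)^k = 1 := by rw [← mul_pow]; simp
  calc _ = (-1)^k * ∑ i ∈ Finset.range (k+1),
        (Nat.choose k i : ℂ) * (poch c i * poch (1 - k - e) (k - i)) := by
        rw [Finset.mul_sum]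
        apply Finset.sum_congr rfl
        intro j hj
        have hj' : j ≤ k := by simpa [Nat.lt_succ_iff] using hj
        have h3 : (1 - k - e : ℂ) = 1 - ((k - j : ℕ) : ℂ) - (e + j) := by
          rw [Nat.cast_sub hj']; ring
        rw [h3, poch_reflect]
        have h4 : ((-1:ℂ))^k * (-1)^(k-j) = (-1)^j := by
          obtain ⟨i, rfl⟩ := Nat.exists_eq_add_of_le hj'
          have : ((-1:ℂ))^i * (-1)^i = 1 := by rw [← mul_pow]; simp
          rw [Nat.add_sub_cancel_left, pow_add, mul_assoc, this, mul_one]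
        rw [← h4]; ring
    _ = _ := by rw [h, ← mul_assoc, hs, one_mul]

/-- terminating 3F2 transformation -/
lemma threeF2 (N : ℕ) (b c e X : ℂ) (he : notNonposInt e) :
    ∑ m ∈ Finset.range (N+1), (-1)^m * (Nat.choose N m : ℂ) * poch b m * poch c m / poch e m
        * poch (X + m) (N - m)
      = ∑ k ∈ Finset.range (N+1), (Nat.choose N k : ℂ) * poch b k * poch (e - c) k / poch e k
        * poch (X - b) (N - k) := by
  symm
  calc _ = ∑ k ∈ Finset.range (N+1), ∑ j ∈ Finset.range (k+1),
        (Nat.choose N k : ℂ) * poch b k * ((-1)^j * (Nat.choose k j : ℂ) * poch c j / poch e j)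
          * poch (X - b) (N - k) := by
        apply Finset.sum_congr rfl
        intro k hk
        rw [← vander2, Finset.mul_sum, Finset.sum_div, Finset.sum_mul]
        apply Finset.sum_congr rfl
        intro j hj
        have hj' : j ≤ k := by simpa [Nat.lt_succ_iff] using hj
        have h1 : poch e k = poch e j * poch (e + j) (k - j) := by
          rw [← poch_add]; congr 1; omega
        have h2 := poch_ne_zero he k
        have h3 := poch_ne_zero he j
        have h4 : poch (e + j) (k - j) ≠ 0 := by
          intro h; rw [h1, h] at h2; simp at h2
        rw [h1]
        field_simp
    _ = ∑ j ∈ Finset.range (N+1), ∑ k ∈ Finset.Ico j (N+1),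
        (Nat.choose N k : ℂ) * poch b k * ((-1)^j * (Nat.choose k j : ℂ) * poch c j / poch e j)
          * poch (X - b) (N - k) := by
        apply Finset.sum_comm'
        intro x y
        simp only [Finset.mem_range, Finset.mem_Ico]
        omega
    _ = _ := by
        apply Finset.sum_congr rfl
        intro j hj
        have hj' : j ≤ N := by simpa [Nat.lt_succ_iff] using hj
        obtain ⟨M, rfl⟩ := Nat.exists_eq_add_of_le hj'
        have h1 : X + (j:ℂ) = (b + j) + (X - b) := by ring
        rw [Finset.sum_Ico_eq_sum_range, Nat.add_sub_cancel_left, h1, ← vander, Finset.mul_sum,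
          show j + M + 1 - j = M + 1 by omega]
        apply Finset.sum_congr rfl
        intro i hi
        have hi' : i ≤ M := by simpa [Nat.lt_succ_iff] using hi
        have h2 : ((j+M).choose (j+i) : ℂ) * ((j+i).choose j : ℂ)
            = ((j+M).choose j : ℂ) * (M.choose i : ℂ) := by
          have := Nat.choose_mul (n := j+M) (k := j+i) (s := j) (by omega)
          rw [Nat.add_sub_cancel_left, Nat.add_sub_cancel_left] at this
          exact_mod_cast this
        rw [poch_add, show j + M - (j + i) = M - i by omega]
        linear_combination (poch b j * poch (b+j) i * (-1)^j * poch c j / poch e j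
          * poch (X - b) (M - i)) * h2

lemma inv_Gamma_shift (g : ℂ) (k : ℕ) : (Gamma g)⁻¹ = poch g k * (Gamma (g + k))⁻¹ := by
  induction k with
  | zero => simp [poch]
  | succ k ih =>
    have := one_div_Gamma_eq_self_mul_one_div_Gamma_add_one (g + k)
    rw [ih, poch_succ, mul_assoc]
    congr 1
    rw [Nat.cast_succ, ← add_assoc]
    simpa [one_div] using this

/-- asymptotics -/
lemma poch_asymp (s : ℂ) :
    Tendsto (fun n : ℕ => poch s (n+1) / ((n:ℂ)^s * (Nat.factorial n : ℂ))) atTop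
      (𝓝 (Gamma s)⁻¹) := by
  have h0 : ∀ n : ℕ, poch s (n+1) / ((n:ℂ)^s * (Nat.factorial n : ℂ)) = (GammaSeq s n)⁻¹ := by
    intro n; rw [GammaSeq, inv_div, poch]
  simp_rw [h0]
  by_cases h : Gamma s = 0
  · obtain ⟨m, hm⟩ := (Gamma_eq_zero_iff s).mp h
    rw [h, inv_zero]
    apply tendsto_const_nhds.congr'
    filter_upwards [eventually_ge_atTop m] with n hn
    rw [GammaSeq, Finset.prod_eq_zero (i := m)]
    · simp
    · simp; omega
    · rw [hm]; ring
  · exact (GammaSeq_tendsto_Gamma s).inv₀ h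

lemma Gamma_ne {s : ℂ} (h : notNonposInt s) : Gamma s ≠ 0 := Gamma_ne_zero h

/-- 3F2 term at 1 -/
noncomputable def tm (a b c f g : ℂ) (n : ℕ) : ℂ :=
  poch a n * poch b n * poch c n / (poch f n * poch g n * (Nat.factorial n : ℂ))

lemma tm_asymp (a b c f g : ℂ) (hf : notNonposInt f) (hg : notNonposInt g) :
    ∃ L, Tendsto (fun n : ℕ => ((n:ℂ)+1) * tm a b c f g (n+1) * (n:ℂ)^(f+g-a-b-c)) atTop (𝓝 L) := by
  refine ⟨_, ((((poch_asymp a).mul (poch_asymp b)).mul (poch_asymp c)).mul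
    (((poch_asymp f).inv₀ (inv_ne_zero (Gamma_ne hf))).mul
    ((poch_asymp g).inv₀ (inv_ne_zero (Gamma_ne hg))))).congr' ?_⟩
  filter_upwards [eventually_ge_atTop 1] with n hn
  have hn0 : (n:ℂ) ≠ 0 := by exact_mod_cast (by omega : n ≠ 0)
  have hn1 : (n:ℂ) + 1 ≠ 0 := by exact_mod_cast (by omega : n + 1 ≠ 0)
  have hF : (Nat.factorial n : ℂ) ≠ 0 := by exact_mod_cast Nat.factorial_ne_zero n
  have h1 := poch_ne_zero hf (n+1)
  have h2 := poch_ne_zero hg (n+1)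
  have ha : (n:ℂ)^a ≠ 0 := by simp [cpow_eq_zero_iff, hn0]
  have hb : (n:ℂ)^b ≠ 0 := by simp [cpow_eq_zero_iff, hn0]
  have hc : (n:ℂ)^c ≠ 0 := by simp [cpow_eq_zero_iff, hn0]
  have hf : (n:ℂ)^f ≠ 0 := by simp [cpow_eq_zero_iff, hn0]
  have hg : (n:ℂ)^g ≠ 0 := by simp [cpow_eq_zero_iff, hn0]
  rw [cpow_sub _ _ hn0, cpow_sub _ _ hn0, cpow_sub _ _ hn0, cpow_add _ _ hn0, tm,
    Nat.factorial_succ]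
  push_cast
  field_simp

lemma tm_bigO (a b c f g : ℂ) (hf : notNonposInt f) (hg : notNonposInt g) :
    (fun n : ℕ => ((n:ℂ)+1) * tm a b c f g (n+1)) =O[atTop]
      (fun n : ℕ => (n:ℝ)^(-(f+g-a-b-c).re)) := by
  obtain ⟨L, hL⟩ := tm_asymp a b c f g hf hg
  have h1 := hL.isBigO_one ℝ
  have h2 : (fun n : ℕ => (n:ℂ)^(-(f+g-a-b-c))) =O[atTop]
      (fun n : ℕ => (n:ℝ)^(-(f+g-a-b-c).re)) := by
    apply Asymptotics.IsBigO.of_bound 1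
    filter_upwards [eventually_ge_atTop 1] with n hn
    rw [norm_natCast_cpow_of_pos hn, one_mul, Complex.neg_re]
    exact le_abs_self _
  have h3 := h1.mul h2
  simp only [one_mul] at h3
  refine h3.congr' ?_ EventuallyEq.rfl
  filter_upwards [eventually_ge_atTop 1] with n hn
  have hn0 : (n:ℂ) ≠ 0 := by exact_mod_cast (by omega : n ≠ 0)
  rw [mul_assoc, ← cpow_add _ _ hn0]
  simp

lemma tm_summable (a b c f g : ℂ) (hf : notNonposInt f) (hg : notNonposInt g)
    (hs : 0 < (f+g-a-b-c).re) : Summable (tm a b c f g) := by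
  rw [← summable_nat_add_iff 1]
  have h1 := tm_bigO a b c f g hf hg
  have h2 : (fun n : ℕ => ((n:ℂ)+1)⁻¹) =O[atTop] (fun n : ℕ => (n:ℝ)^(-1:ℝ)) := by
    apply Asymptotics.IsBigO.of_bound 1
    filter_upwards [eventually_ge_atTop 1] with n hn
    have hn' : (0:ℝ) < n := by exact_mod_cast hn
    rw [one_mul, Real.rpow_neg_one, norm_inv, norm_inv]
    apply inv_anti₀ (norm_pos_iff.mpr hn'.ne')
    have : ((n:ℂ)+1) = ((n+1 : ℕ) : ℂ) := by push_cast; rfl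
    rw [this, Complex.norm_natCast]
    simp
  have h3 := h2.mul h1
  refine summable_of_isBigO_nat (g := fun n : ℕ => (n:ℝ)^(-1 -(f+g-a-b-c).re)) ?_ (h3.congr' ?_ ?_)
  · rw [Real.summable_nat_rpow]; linarith
  · filter_upwards with n
    have hn1 : (n:ℂ) + 1 ≠ 0 := by exact_mod_cast (by omega : n + 1 ≠ 0)
    field_simp
  · filter_upwards [eventually_ge_atTop 1] with n hn
    have hn' : (0:ℝ) < n := by exact_mod_cast hn
    rw [← Real.rpow_add hn']; rfl

lemma tm_tendsto (a b c f g : ℂ) (hf : notNonposInt f) (hg : notNonposInt g)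
    (hs : 0 < (f+g-a-b-c).re) :
    Tendsto (fun n : ℕ => (n:ℂ) * tm a b c f g n) atTop (𝓝 0) := by
  rw [← tendsto_add_atTop_iff_nat 1]
  push_cast
  exact (tm_bigO a b c f g hf hg).trans_tendsto
    ((tendsto_rpow_neg_atTop hs).comp tendsto_natCast_atTop_atTop)

/-- 2F1 term at 1 -/
noncomputable def gtm (a b c : ℂ) (n : ℕ) : ℂ :=
  poch a n * poch b n / (poch c n * (Nat.factorial n : ℂ))

lemma one_nn : notNonposInt 1 := by
  intro k h
  have : ((1 + k : ℕ) : ℂ) = 0 := by push_cast; rw [h]; ring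
  rw [Nat.cast_eq_zero] at this; omega

lemma gtm_eq_tm (a b c : ℂ) : gtm a b c = tm a b 1 c 1 := by
  funext n
  have := poch_ne_zero one_nn n
  rw [gtm, tm, show poch c n * poch 1 n * (Nat.factorial n : ℂ)
    = (poch c n * (Nat.factorial n : ℂ)) * poch 1 n by ring, mul_div_mul_right _ _ this]

lemma gtm_summable (a b c : ℂ) (hc : notNonposInt c) (hs : 0 < (c-a-b).re) :
    Summable (gtm a b c) := by
  rw [gtm_eq_tm]
  apply tm_summable _ _ _ _ _ hc one_nn
  rwa [show c + 1 - a - b - 1 = c - a - b by ring]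

lemma gtm_tendsto (a b c : ℂ) (hc : notNonposInt c) (hs : 0 < (c-a-b).re) :
    Tendsto (fun n : ℕ => (n:ℂ) * gtm a b c n) atTop (𝓝 0) := by
  rw [gtm_eq_tm]
  apply tm_tendsto _ _ _ _ _ hc one_nn
  rwa [show c + 1 - a - b - 1 = c - a - b by ring]

lemma nn_add {c : ℂ} (hc : notNonposInt c) (k : ℕ) : notNonposInt (c + k) := by
  intro j h
  apply hc (j + k)
  push_cast
  linear_combination h

lemma nn_of_re {c : ℂ} (hc : 0 < c.re) : notNonposInt c := by
  intro j h
  rw [h] at hc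
  simp at hc
  have : (0:ℝ) ≤ j := Nat.cast_nonneg j
  linarith

lemma gauss_contig (a b c : ℂ) (hc : notNonposInt c) (hs : 0 < (c-a-b).re) :
    c * (c-a-b) * ∑' n, gtm a b c n = (c-a)*(c-b) * ∑' n, gtm a b (c+1) n := by
  have hc1 : notNonposInt (c+1) := by simpa using nn_add hc 1
  have hs1 : 0 < (c+1-a-b).re := by
    rw [show c+1-a-b = (c-a-b)+1 by ring, add_re, one_re]; linarith
  have S1 := (gtm_summable a b c hc hs).hasSum.mul_left (c*(c-a-b))
  have S2 := (gtm_summable a b (c+1) hc1 hs1).hasSum.mul_left ((c-a)*(c-b))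
  have S3 := (S1.sub S2).tendsto_sum_nat
  have h : ∀ K : ℕ, ∑ n ∈ Finset.range K, (c*(c-a-b)*gtm a b c n - (c-a)*(c-b)*gtm a b (c+1) n)
      = -c * ((K:ℂ) * gtm a b c K) := by
    intro K
    induction K with
    | zero => simp
    | succ K ih =>
      rw [Finset.sum_range_succ, ih]
      have hcK : c + K ≠ 0 := fun h => hc K (eq_neg_of_add_eq_zero_left h)
      have hc0 : c ≠ 0 := fun h => hc 0 (by simpa using h)
      have hp := poch_ne_zero hc K
      have hp1 := poch_ne_zero hc1 K
      have hF : (Nat.factorial K : ℂ) ≠ 0 := by exact_mod_cast Nat.factorial_ne_zero K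
      have hn1 : (K:ℂ) + 1 ≠ 0 := by exact_mod_cast (by omega : K + 1 ≠ 0)
      have e1 : poch (c+1) K = poch c K * (c+K) / c := by
        rw [eq_div_iff hc0, ← poch_succ, poch_succ']; ring
      simp only [gtm]
      rw [e1, poch_succ, poch_succ, poch_succ, Nat.factorial_succ]
      push_cast
      field_simp
      ring
  simp_rw [h] at S3
  have S4 := (gtm_tendsto a b c hc hs).const_mul (-c)
  rw [mul_zero] at S4
  exact sub_eq_zero.mp (tendsto_nhds_unique S3 S4)

lemma gauss_iter (a b c : ℂ) (hc : notNonposInt c) (hs : 0 < (c-a-b).re) (k : ℕ) :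
    ∑' n, gtm a b c n = poch (c-a) k * poch (c-b) k / (poch c k * poch (c-a-b) k)
      * ∑' n, gtm a b (c+k) n := by
  induction k with
  | zero => simp [poch]
  | succ k ih =>
    have hck := nn_add hc k
    have hs' : 0 < (c+k-a-b).re := by
      rw [show c+k-a-b = (c-a-b)+(k:ℂ) by ring, add_re, natCast_re]
      have : (0:ℝ) ≤ k := Nat.cast_nonneg k
      linarith
    have h := gauss_contig a b (c+k) hck hs'
    have h1 : c + k ≠ 0 := by simpa using hck 0
    have h2 : c + k - a - b ≠ 0 := by intro h; rw [h] at hs'; simp at hs'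
    have h2' : c - a - b + k ≠ 0 := by convert h2 using 1; ring
    have h3 := poch_ne_zero hc k
    have h4 := poch_ne_zero (nn_of_re hs) k
    rw [ih, poch_succ, poch_succ, poch_succ, poch_succ, Nat.cast_succ, ← add_assoc]
    have h5 : ∑' n, gtm a b (c+k) n = (c+k-a)*(c+k-b) * (∑' n, gtm a b (c+k+1) n)
        / ((c+k)*(c+k-a-b)) := by
      rw [eq_div_iff (mul_ne_zero h1 h2), ← h]; ring
    rw [h5]
    rw [show c + k - a - b = c - a - b + k by ring]
    field_simp
    ring

lemma norm_poch_le (a : ℂ) (n : ℕ) : ‖poch a n‖ ≤ ‖poch (‖a‖ : ℂ) n‖ := by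
  rw [poch, poch, norm_prod, norm_prod]
  apply Finset.prod_le_prod (fun _ _ => norm_nonneg _)
  intro i _
  have : ((‖a‖:ℂ) + i) = ((‖a‖ + i : ℝ) : ℂ) := by push_cast; rfl
  rw [this, Complex.norm_real, Real.norm_of_nonneg (by positivity)]
  simpa using norm_add_le a (i:ℂ)

lemma norm_poch_ge (r : ℝ) (hr : 0 < r) (a : ℂ) (ha : r ≤ a.re) (n : ℕ) :
    ‖poch (r : ℂ) n‖ ≤ ‖poch a n‖ := by
  rw [poch, poch, norm_prod, norm_prod]
  apply Finset.prod_le_prod (fun _ _ => norm_nonneg _)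
  intro i _
  have : ((r:ℂ) + i) = ((r + i : ℝ) : ℂ) := by push_cast; rfl
  rw [this, Complex.norm_real, Real.norm_of_nonneg (by positivity)]
  calc r + i ≤ (a + i).re := by simpa using ha
    _ ≤ _ := re_le_norm _

lemma gauss_lim (a b c : ℂ) :
    Tendsto (fun k : ℕ => ∑' n, gtm a b (c+k) n) atTop (𝓝 1) := by
  set r : ℝ := ‖a‖ + ‖b‖ + 1 with hr
  have hr0 : 0 < r := by positivity
  obtain ⟨k0, hk0⟩ := exists_nat_ge (r - c.re)
  have hS : Summable (fun n => ‖gtm (‖a‖:ℂ) (‖b‖:ℂ) (r:ℂ) n‖) := by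
    apply (gtm_summable _ _ _ _ _).norm
    · apply nn_of_re; simpa using hr0
    · simp [hr]; linarith
  have h1 : (1:ℂ) = ∑' n : ℕ, (if n = 0 then 1 else 0) := by simp
  rw [h1]
  apply tendsto_tsum_of_dominated_convergence hS
  · intro n
    rcases n with _ | n
    · simp [gtm, poch]
    · simp only [Nat.succ_ne_zero, if_false]
      rw [tendsto_zero_iff_norm_tendsto_zero]
      have key : Tendsto (fun k : ℕ => ‖poch a (n+1) * poch b (n+1) / (Nat.factorial (n+1) : ℂ)‖
          / ‖poch (r:ℂ) n‖ * ((c.re + k)⁻¹)) atTop (𝓝 0) := by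
        have : Tendsto (fun k : ℕ => (c.re + (k:ℝ))⁻¹) atTop (𝓝 0) :=
          tendsto_inv_atTop_zero.comp (tendsto_atTop_add_const_left _ _ tendsto_natCast_atTop_atTop)
        simpa using this.const_mul (‖poch a (n+1) * poch b (n+1) / (Nat.factorial (n+1) : ℂ)‖
          / ‖poch (r:ℂ) n‖)
      refine squeeze_zero' (Eventually.of_forall fun _ => norm_nonneg _) ?_ key
      filter_upwards [eventually_ge_atTop k0] with k hk
      have hk' : (k0:ℝ) ≤ k := by exact_mod_cast hk
      have hck : r ≤ c.re + k := by linarith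
      have g1 := norm_poch_ge r hr0 (c+k+1) (by simp; linarith) n
      have g2 : c.re + k ≤ ‖c+k‖ := by simpa using re_le_norm (c+k)
      have g3 : 0 < ‖poch (r:ℂ) n‖ := norm_pos_iff.mpr (poch_ne_zero (nn_of_re (by simpa using hr0)) n)
      have g4 : 0 < c.re + k := by linarith
      rw [gtm, poch_succ' (c+k), show poch a (n+1) * poch b (n+1) / ((c+k) * poch (c+k+1) n *
        (Nat.factorial (n+1) : ℂ)) = poch a (n+1) * poch b (n+1) / (Nat.factorial (n+1) : ℂ)
          / (poch (c+k+1) n) * (c+k)⁻¹ by rw [← div_eq_mul_inv, div_div, div_div]; congr 1; ring,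
        norm_mul, norm_div _ (poch (c+k+1) n), norm_inv]
      gcongr
  · filter_upwards [eventually_ge_atTop k0] with k hk n
    have hk' : (k0:ℝ) ≤ k := by exact_mod_cast hk
    have hck : r ≤ (c + k).re := by simp; linarith
    have g1 := norm_poch_ge r hr0 (c+k) hck n
    have g3 : 0 < ‖poch (r:ℂ) n‖ := norm_pos_iff.mpr (poch_ne_zero (nn_of_re (by simpa using hr0)) n)
    have hF : (0:ℝ) < ‖(Nat.factorial n : ℂ)‖ := by
      rw [norm_pos_iff]; exact_mod_cast Nat.factorial_ne_zero n
    rw [gtm, gtm, norm_div, norm_div, norm_mul, norm_mul, norm_mul, norm_mul]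
    have := norm_poch_le a n
    have := norm_poch_le b n
    gcongr

theorem gauss (a b c : ℂ) (hc : notNonposInt c) (hs : 0 < (c-a-b).re) :
    ∑' n, gtm a b c n = Gamma c * Gamma (c-a-b) * (Gamma (c-a))⁻¹ * (Gamma (c-b))⁻¹ := by
  have hs0 := nn_of_re hs
  have L := ((((poch_asymp (c-a)).mul (poch_asymp (c-b))).mul
    (((poch_asymp c).inv₀ (inv_ne_zero (Gamma_ne hc))).mul
    ((poch_asymp (c-a-b)).inv₀ (inv_ne_zero (Gamma_ne hs0))))).mul
      ((tendsto_add_atTop_iff_nat 1).mpr (gauss_lim a b c)))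
  have L2 : Tendsto (fun _ : ℕ => ∑' n, gtm a b c n) atTop (𝓝 (∑' n, gtm a b c n)) :=
    tendsto_const_nhds
  have := tendsto_nhds_unique L2 (L.congr' ?_)
  · rw [this]; simp only [inv_inv]; ring
  · filter_upwards [eventually_ge_atTop 1] with n hn
    rw [gauss_iter a b c hc hs (n+1)]
    congr 1
    have hn0 : (n:ℂ) ≠ 0 := by exact_mod_cast (by omega : n ≠ 0)
    have hF : (Nat.factorial n : ℂ) ≠ 0 := by exact_mod_cast Nat.factorial_ne_zero n
    have h1 := poch_ne_zero hc (n+1)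
    have h2 := poch_ne_zero hs0 (n+1)
    have ha : (n:ℂ)^a ≠ 0 := by simp [cpow_eq_zero_iff, hn0]
    have hb : (n:ℂ)^b ≠ 0 := by simp [cpow_eq_zero_iff, hn0]
    have hc : (n:ℂ)^c ≠ 0 := by simp [cpow_eq_zero_iff, hn0]
    rw [cpow_sub _ _ hn0, cpow_sub _ _ hn0, cpow_sub _ _ hn0, cpow_sub _ _ hn0]
    field_simp


theorem kdf_summation_g2 (N : ℕ) (hN : 0 < N) (b c c' d : ℂ)
    (hconv : 0 < ((1 : ℂ) - N + b + c - d).re)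
    (hd : notNonposInt d) (he : notNonposInt (1 - N + b + c - d))
    (hee : notNonposInt (1 + c + c')) :
    (∑' (m : ℕ) (n : ℕ),
        poch (-(N : ℂ)) m * poch b m * poch c m *
            poch (d + N) n * poch (d - b) n * poch c' n /
          (poch d (m + n) * poch (1 - N + b + c - d) m * poch (1 + c + c') n *
            (Nat.factorial m : ℂ) * (Nat.factorial n : ℂ))) =
      poch (d - b) N * poch (d - c - c') N / (poch d N * poch (d - b - c) N) *
        (Complex.Gamma (1 + c + c') * Complex.Gamma (1 + b + c - d) /
          (Complex.Gamma (1 + c) * Complex.Gamma (1 + b + c + c' - d))) := by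
  obtain ⟨e, hedef⟩ : ∃ e : ℂ, e = 1 - N + b + c - d := ⟨_, rfl⟩
  rw [← hedef] at hconv he ⊢
  have hdN := poch_ne_zero hd N
  -- truncate the outer sum
  rw [tsum_eq_sum (s := Finset.range (N+1)) (by
    intro m hm
    have hm' : N < m := by simpa [Nat.lt_succ_iff] using hm
    rw [poch_neg_nat, Nat.choose_eq_zero_of_lt hm']
    simp)]
  -- interchange
  rw [← Summable.tsum_finsetSum (by
    intro m _
    have hdm := nn_add hd m
    have hmr : (0:ℝ) ≤ m := Nat.cast_nonneg m
    have hs := tm_summable (d+N) (d-b) c' (d+m) (1+c+c') hdm hee (by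
      rw [show d+m+(1+c+c')-(d+N)-(d-b)-c' = e + m by rw [hedef]; ring, add_re, natCast_re]
      linarith)
    refine (hs.mul_left (poch (-(N : ℂ)) m * poch b m * poch c m /
      (poch d m * poch e m * (Nat.factorial m : ℂ)))).congr ?_
    intro n
    rw [tm, poch_add, div_mul_div_comm]
    congr 1 <;> ring)]
  have hterm : ∀ n : ℕ, ∑ m ∈ Finset.range (N+1), poch (-(N : ℂ)) m * poch b m * poch c m *
            poch (d + N) n * poch (d - b) n * poch c' n /
          (poch d (m + n) * poch e m * poch (1 + c + c') n *
            (Nat.factorial m : ℂ) * (Nat.factorial n : ℂ)) =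
      ∑ k ∈ Finset.range (N+1), (poch (d-b) N / poch d N *
        ((-1)^k * (Nat.choose N k : ℂ) * poch b k / poch e k)) *
          gtm (d - b + (N - k : ℕ)) c' (1 + c + c') n := by
    intro n
    have hFn : (Nat.factorial n : ℂ) ≠ 0 := by exact_mod_cast Nat.factorial_ne_zero n
    have hgn := poch_ne_zero hee n
    calc _ = gtm (d - b) c' (1+c+c') n / poch d N * ∑ m ∈ Finset.range (N+1),
          (-1)^m * (Nat.choose N m : ℂ) * poch b m * poch c m / poch e m
            * poch ((d + n) + m) (N - m) := by
          rw [Finset.mul_sum]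
          apply Finset.sum_congr rfl
          intro m hm
          have hm' : m ≤ N := by simpa [Nat.lt_succ_iff] using hm
          have hFm : (Nat.factorial m : ℂ) ≠ 0 := by exact_mod_cast Nat.factorial_ne_zero m
          have h1 : poch d (m+n) * poch (d + n + m) (N - m) = poch d N * poch (d + N) n := by
            rw [← poch_add, show d + n + m = d + ((m + n : ℕ) : ℂ) by push_cast; ring, ← poch_add]
            congr 1; omega
          have h2 := poch_ne_zero hd (m+n)
          have h3 := poch_ne_zero he m
          have h4 : poch (d + n + m) (N - m) = poch d N * poch (d + N) n / poch d (m+n) := by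
            rw [eq_div_iff h2, ← h1]; ring
          rw [h4, poch_neg_nat, gtm]
          field_simp
      _ = _ := by
          rw [threeF2 N b c e (d+n) he, Finset.mul_sum]
          apply Finset.sum_congr rfl
          intro k hk
          have hk' : k ≤ N := by simpa [Nat.lt_succ_iff] using hk
          have h3 := poch_ne_zero he k
          have h5 : poch (e - c) k = (-1)^k * poch (d - b + (N - k : ℕ)) k := by
            rw [← poch_reflect]
            congr 1
            rw [hedef, Nat.cast_sub hk']; ring
          have h6 : poch (d - b) N = poch (d - b) (N - k) * poch (d - b + (N - k : ℕ)) k := by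
            rw [← poch_add]; congr 1; omega
          have h7 : poch (d - b) n * poch (d + n - b) (N - k)
              = poch (d - b) (N - k) * poch (d - b + (N - k : ℕ)) n := by
            rw [show d + n - b = d - b + n by ring, ← poch_add, ← poch_add, add_comm]
          rw [h5, h6, gtm, gtm]
          field_simp
          linear_combination (poch c' n * (Nat.choose N k : ℂ) * poch b k *
            poch (d - b + (N - k : ℕ)) k) * h7
  rw [tsum_congr hterm]
  have hre : ∀ k : ℕ, k ≤ N → 1 + c + c' - (d - b + (N - k : ℕ)) - c' = e + k := by
    intro k hk
    rw [hedef, Nat.cast_sub hk]; ring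
  have hrepos : ∀ k : ℕ, 0 < (e + k).re := by
    intro k
    have hmr : (0:ℝ) ≤ k := Nat.cast_nonneg k
    rw [add_re, natCast_re]; linarith
  rw [Summable.tsum_finsetSum (by
    intro k hk
    have hk' : k ≤ N := by simpa [Nat.lt_succ_iff] using hk
    exact (gtm_summable _ _ _ hee (by rw [hre k hk']; exact hrepos k)).mul_left _)]
  have hGe := Gamma_ne he
  have hGeN := Gamma_ne (nn_add he N)
  have hGshift : ∀ k : ℕ, Gamma (e + k) = poch e k * Gamma e := by
    intro k
    have h := inv_Gamma_shift e k
    have h2 := Gamma_ne (nn_add he k)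
    field_simp at h
    rw [h]; ring
  have hk : ∀ k ∈ Finset.range (N+1), ∑' n, (poch (d-b) N / poch d N *
        ((-1)^k * (Nat.choose N k : ℂ) * poch b k / poch e k)) *
          gtm (d - b + (N - k : ℕ)) c' (1 + c + c') n =
      (poch (d-b) N / poch d N * (Gamma (1+c+c') * Gamma e * (Gamma (1+c))⁻¹
        * (Gamma (e + c' + N))⁻¹)) * ((-1)^k * (Nat.choose N k : ℂ) *
          (poch b k * poch (e + c' + k) (N - k))) := by
    intro k hk
    have hk' : k ≤ N := by simpa [Nat.lt_succ_iff] using hk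
    have h3 := poch_ne_zero he k
    rw [tsum_mul_left, gauss _ _ _ hee (by rw [hre k hk']; exact hrepos k), hre k hk', hGshift k,
      show 1 + c + c' - (d - b + (N - k : ℕ)) = e + c' + k by linear_combination hre k hk',
      show 1 + c + c' - c' = 1 + c by ring, inv_Gamma_shift (e + c' + k) (N - k),
      show e + c' + k + ((N - k : ℕ) : ℂ) = e + c' + N by rw [Nat.cast_sub hk']; ring]
    field_simp
  rw [Finset.sum_congr rfl hk, ← Finset.mul_sum, vander2]
  have h1 : poch (e + c' - b) N = (-1)^N * poch (d - c - c') N := by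
    rw [← poch_reflect, hedef]; congr 1; ring
  have h2 : poch e N = (-1)^N * poch (d - b - c) N := by
    rw [← poch_reflect, hedef]; congr 1; ring
  have h3 := poch_ne_zero he N
  have h4 : poch (d - b - c) N ≠ 0 := by
    intro h; rw [h2, h] at h3; simp at h3
  have h5 : Gamma (1 + b + c - d) = poch e N * Gamma e := by
    rw [← hGshift, hedef]; congr 1; ring
  rw [h1, h5, h2, show e + c' + N = 1 + b + c + c' - d by rw [hedef]; ring, div_eq_mul_inv _ (Gamma (1+c) * _),
    mul_inv]
  field_simp
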